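/- arXiv:2205.08226 — 2 statements merged into one kernel-verified Lean document; each statement's English description precedes it below -/
import Mathlib

section
/- For all integers m ≥ 0 and 0 ≤ j ≤ m, the function 𝔢_{j,m-j} is invariant under the weight-(m-2j) vector-valued slash action of the full group SL(2,ℝ): for every g = [[a,b],[c,d]] ∈ SL(2,ℝ), every τ in the upper half plane ℍ, and every X ∈ ℂ with cX+d ≠ 0, one has (cX+d)^m · (cτ+d)^{-(m-2j)} · 𝔢_{j,m-j}(gτ, (aX+b)/(cX+d)) = 𝔢_{j,m-j}(τ, X), where gτ = (aτ+b)/(cτ+d). -/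
open Complex

/-- `ee j n τ X` is the function `𝔢_{j,n}(τ,X) = ((-1)^n / j!) · (Im τ)^{-n} · (X-τ)^j · (X-conj τ)^n`,
so that `𝔢_{j,m-j} = ee j (m-j)`. -/
noncomputable def ee (j n : ℕ) (τ X : ℂ) : ℂ :=
  ((-1 : ℂ) ^ n / (Nat.factorial j : ℂ)) * (τ.im : ℂ) ^ (-(n : ℤ)) *
    (X - τ) ^ j * (X - (starRingEnd ℂ) τ) ^ n

/-- The difference of two values of a Möbius transformation of determinant one. -/
theorem moebius_sub_moebius {K : Type*} [Field K] {a b c d z w : K} (hdet : a * d - b * c = 1)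
    (hz : c * z + d ≠ 0) (hw : c * w + d ≠ 0) :
    (a * z + b) / (c * z + d) - (a * w + b) / (c * w + d) =
      (z - w) / ((c * z + d) * (c * w + d)) := by
  rw [div_sub_div _ _ hz hw]
  congr 1
  linear_combination (z - w) * hdet

/-- `𝔢_{j,m-j}` is invariant under the weight-`(m-2j)`, type `sym^m` slash action of all of
`SL(2,ℝ)`. -/
theorem e_slash_SL2R_invariant (m j : ℕ) (hj : j ≤ m)
    (g : Matrix.SpecialLinearGroup (Fin 2) ℝ) (τ X : ℂ) (hτ : 0 < τ.im)
    (hX : (g 1 0 : ℂ) * X + (g 1 1 : ℂ) ≠ 0) :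
    ((g 1 0 : ℂ) * X + (g 1 1 : ℂ)) ^ m *
      ((g 1 0 : ℂ) * τ + (g 1 1 : ℂ)) ^ (-((m : ℤ) - 2 * (j : ℤ))) *
      ee j (m - j)
        (((g 0 0 : ℂ) * τ + (g 0 1 : ℂ)) / ((g 1 0 : ℂ) * τ + (g 1 1 : ℂ)))
        (((g 0 0 : ℂ) * X + (g 0 1 : ℂ)) / ((g 1 0 : ℂ) * X + (g 1 1 : ℂ)))
      = ee j (m - j) τ X := by
  have hdet : (g 0 0 : ℂ) * g 1 1 - g 0 1 * g 1 0 = 1 := by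
    have h := g.det_coe
    rw [Matrix.det_fin_two] at h
    exact_mod_cast h
  have hD : (g 1 0 : ℂ) * τ + g 1 1 ≠ 0 := by
    simpa [UpperHalfPlane.denom] using UpperHalfPlane.denom_ne_zero_of_im (g : GL (Fin 2) ℝ) hτ.ne'
  generalize g 0 0 = a, g 0 1 = b, g 1 0 = c, g 1 1 = d at hdet hD hX ⊢
  have hconj : (starRingEnd ℂ) (((a : ℂ) * τ + b) / ((c : ℂ) * τ + d)) =
      ((a : ℂ) * (starRingEnd ℂ) τ + b) / ((c : ℂ) * (starRingEnd ℂ) τ + d) := by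
    simp
  have hDc : (c : ℂ) * (starRingEnd ℂ) τ + d ≠ 0 := by
    simpa using (map_ne_zero (starRingEnd ℂ)).2 hD
  have him : ((((a : ℂ) * τ + b) / ((c : ℂ) * τ + d)).im : ℂ) =
      (τ.im : ℂ) / (((c : ℂ) * τ + d) * ((c : ℂ) * (starRingEnd ℂ) τ + d)) := by
    rw [Complex.im_eq_sub_conj, Complex.im_eq_sub_conj, hconj,
      moebius_sub_moebius hdet hD hDc, div_right_comm]
  have hy : (τ.im : ℂ) ≠ 0 := by exact_mod_cast hτ.ne'
  obtain ⟨n, rfl⟩ := Nat.exists_eq_add_of_le hj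
  have hexp : -(((j + n : ℕ) : ℤ) - 2 * (j : ℤ)) = (j : ℤ) - n := by
    push_cast
    ring
  rw [Nat.add_sub_cancel_left, hexp, zpow_sub₀ hD]
  simp only [ee]
  rw [him, hconj, moebius_sub_moebius hdet hX hD, moebius_sub_moebius hdet hX hDc]
  simp only [zpow_neg, zpow_natCast, div_pow, mul_pow, pow_add]
  field_simp
end

section
/- The vector-valued Eisenstein series E_2^vec is modular of weight 1 and type sym^1: for every γ = [[a,b],[c,d]] ∈ SL(2,ℤ), every τ ∈ ℍ, and every X ∈ ℂ with cX+d ≠ 0, one has (cX+d)·(cτ+d)^{-1}·E_2^vec(γτ, (aX+b)/(cX+d)) = E_2^vec(τ, X), where γτ = (aτ+b)/(cτ+d). -/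
open Complex

/-- `σ₁(n)`, the sum of the divisors of `n`. -/
def sigma1 (n : ℕ) : ℕ := ∑ d ∈ n.divisors, d

/-- The quasimodular Eisenstein series `E₂^hol(τ) = 1 - 24 Σ_{n≥1} σ₁(n) e^{2πinτ}`. -/
noncomputable def E2hol (τ : ℂ) : ℂ :=
  1 - 24 * ∑' n : ℕ, (sigma1 (n + 1) : ℂ) *
    Complex.exp (2 * Real.pi * Complex.I * ((n : ℂ) + 1) * τ)

/-- The vector-valued Eisenstein series `E₂^vec(τ, X) = (X - τ)·E₂^hol(τ) - 6/(πi)`. -/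
noncomputable def E2vec (τ X : ℂ) : ℂ :=
  (X - τ) * E2hol τ - 6 / ((Real.pi : ℂ) * Complex.I)

/-- `E2hol` restricts to Mathlib's `EisensteinSeries.E2` on the upper half plane. -/
theorem E2hol_eq_E2 (z : UpperHalfPlane) : E2hol z = EisensteinSeries.E2 z := by
  rw [EisensteinSeries.E2_eq_tsum_cexp, E2hol, tsum_pnat_eq_tsum_succ
    (f := fun n ↦ (ArithmeticFunction.sigma 1 n : ℂ) *
      Complex.exp (2 * Real.pi * Complex.I * z) ^ n)]
  congr 2
  refine tsum_congr fun n ↦ ?_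
  rw [← Complex.exp_nat_mul, ArithmeticFunction.sigma_one_apply, sigma1]
  congr 2
  push_cast
  ring

/-- The quasimodular transformation law of `E₂`. -/
theorem E2_smul (γ : Matrix.SpecialLinearGroup (Fin 2) ℤ) (z : UpperHalfPlane) :
    EisensteinSeries.E2 (γ • z) = ((γ 1 0 : ℂ) * z + (γ 1 1 : ℂ)) ^ 2 * EisensteinSeries.E2 z -
      6 * Complex.I * (γ 1 0 : ℂ) / Real.pi * ((γ 1 0 : ℂ) * z + (γ 1 1 : ℂ)) := by
  have hden : UpperHalfPlane.denom γ z = (γ 1 0 : ℂ) * z + (γ 1 1 : ℂ) :=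
    ModularGroup.denom_apply γ z
  have hD : (γ 1 0 : ℂ) * z + (γ 1 1 : ℂ) ≠ 0 := hden ▸ UpperHalfPlane.denom_ne_zero γ z
  have hpi : (Real.pi : ℂ) ≠ 0 := Complex.ofReal_ne_zero.mpr Real.pi_ne_zero
  have h := congrFun (EisensteinSeries.E2_slash_action γ) z
  simp only [ModularForm.SL_slash_apply, Pi.sub_apply, Pi.smul_apply, EisensteinSeries.D2,
    hden, riemannZeta_two, smul_eq_mul, zpow_neg] at h
  rw [mul_inv_eq_iff_eq_mul₀ (zpow_ne_zero _ hD)] at h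
  rw [h, zpow_ofNat]
  field_simp

/-- `E₂^vec` is modular of weight `1` and type `sym¹` for `SL(2,ℤ)`. -/
theorem E2vec_modular (γ : Matrix.SpecialLinearGroup (Fin 2) ℤ) (τ X : ℂ)
    (hτ : 0 < τ.im) (hX : (γ 1 0 : ℂ) * X + (γ 1 1 : ℂ) ≠ 0) :
    ((γ 1 0 : ℂ) * X + (γ 1 1 : ℂ)) * ((γ 1 0 : ℂ) * τ + (γ 1 1 : ℂ))⁻¹ *
        E2vec (((γ 0 0 : ℂ) * τ + (γ 0 1 : ℂ)) / ((γ 1 0 : ℂ) * τ + (γ 1 1 : ℂ)))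
              (((γ 0 0 : ℂ) * X + (γ 0 1 : ℂ)) / ((γ 1 0 : ℂ) * X + (γ 1 1 : ℂ)))
      = E2vec τ X := by
  lift τ to UpperHalfPlane using hτ
  have hD : (γ 1 0 : ℂ) * τ + (γ 1 1 : ℂ) ≠ 0 :=
    ModularGroup.denom_apply γ τ ▸ UpperHalfPlane.denom_ne_zero γ τ
  have hdet : (γ 0 0 : ℂ) * γ 1 1 - γ 0 1 * γ 1 0 = 1 := by
    exact_mod_cast (Matrix.det_fin_two γ.1).symm.trans γ.2
  have hsmul : ((γ 0 0 : ℂ) * τ + (γ 0 1 : ℂ)) / ((γ 1 0 : ℂ) * τ + (γ 1 1 : ℂ)) =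
      (γ • τ : UpperHalfPlane) := by
    rw [UpperHalfPlane.coe_specialLinearGroup_apply]
    simp
  have hsub : ((γ 0 0 : ℂ) * X + γ 0 1) / ((γ 1 0 : ℂ) * X + γ 1 1) -
      ((γ 0 0 : ℂ) * τ + γ 0 1) / ((γ 1 0 : ℂ) * τ + γ 1 1) =
      (X - τ) / (((γ 1 0 : ℂ) * X + γ 1 1) * ((γ 1 0 : ℂ) * τ + γ 1 1)) := by
    rw [div_sub_div _ _ hX hD]
    congr 1
    linear_combination (X - τ) * hdet
  have hpi : (Real.pi : ℂ) ≠ 0 := Complex.ofReal_ne_zero.mpr Real.pi_ne_zero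
  have hI : 6 / ((Real.pi : ℂ) * Complex.I) = -(6 * Complex.I / Real.pi) := by
    rw [mul_comm, ← div_div, div_eq_mul_inv 6 Complex.I, Complex.inv_I]
    ring
  rw [E2vec, E2vec, hsub, hsmul, E2hol_eq_E2, E2hol_eq_E2, E2_smul, hI]
  field_simp
  ring
end
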